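/- arXiv:2207.14377 — 4 statements merged into one kernel-verified Lean document; each statement's English description precedes it below -/
import Mathlib

section
/- There exists an absolute constant C > 0 such that for every integer d ≥ 3 there is q₀ = q₀(d) with the following property: for every prime q ≥ q₀ with d | (q−1) and every primitive Dirichlet character χ modulo q of order d, there exists a positive integer n ≤ q^{δ} with χ(n) ≠ 1, where δ := log log(C·d·log d)/log d. -/
open ArithmeticFunction in
theorem aux_log_factorial (N : ℕ) :
    ∑ k ∈ Finset.Ioc 0 N, vonMangoldt k * ((N / k : ℕ) : ℝ) = Real.log (N.factorial : ℝ) := by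
  rw [← sum_Ioc_mul_zeta_eq_sum, vonMangoldt_mul_zeta]
  induction N with
  | zero => simp
  | succ n ih =>
    rw [Finset.sum_Ioc_succ_top (by omega), ih, Nat.factorial_succ]
    push_cast
    rw [Real.log_mul (by positivity) (by positivity)]
    simp [ArithmeticFunction.log_apply, add_comm]

open ArithmeticFunction in
theorem aux_mertens_lower (N : ℕ) (hN : 1 ≤ N) :
    Real.log N - 1 ≤ ∑ k ∈ Finset.Ioc 0 N, vonMangoldt k / k := by
  have hN0 : (0 : ℝ) < N := by exact_mod_cast hN
  have h1 : Real.log (N.factorial : ℝ) ≤ N * ∑ k ∈ Finset.Ioc 0 N, vonMangoldt k / k := by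
    rw [← aux_log_factorial, Finset.mul_sum]
    refine Finset.sum_le_sum fun k hk => ?_
    have : ((N / k : ℕ) : ℝ) ≤ N / k := Nat.cast_div_le
    calc _ ≤ vonMangoldt k * ((N : ℝ) / k) :=
          mul_le_mul_of_nonneg_left this vonMangoldt_nonneg
      _ = _ := by ring
  have h2 : (N : ℝ) ^ N / (N.factorial : ℝ) ≤ Real.exp N :=
    Real.pow_div_factorial_le_exp _ hN0.le N
  have h3 := Real.log_le_log (by positivity) h2
  rw [Real.log_exp, Real.log_div (by positivity) (by positivity), Real.log_pow] at h3
  have : N * (Real.log N - 1) ≤ N * ∑ k ∈ Finset.Ioc 0 N, vonMangoldt k / k := by linarith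
  exact le_of_mul_le_mul_left this hN0

open ArithmeticFunction in
theorem aux_mertens_upper (N : ℕ) (hN : 1 ≤ N) :
    ∑ k ∈ Finset.Ioc 0 N, vonMangoldt k / k ≤ Real.log N + (Real.log 4 + 4) := by
  have hN0 : (0 : ℝ) < N := by exact_mod_cast hN
  have h1 : N * ∑ k ∈ Finset.Ioc 0 N, vonMangoldt k / k ≤
      Real.log (N.factorial : ℝ) + ∑ k ∈ Finset.Ioc 0 N, vonMangoldt k := by
    rw [← aux_log_factorial, Finset.mul_sum, ← Finset.sum_add_distrib]
    refine Finset.sum_le_sum fun k hk => ?_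
    have : (N : ℝ) / k ≤ ((N / k : ℕ) : ℝ) + 1 := by
      have := (Nat.lt_floor_add_one ((N : ℝ) / k)).le
      rwa [Nat.floor_div_eq_div] at this
    calc _ = vonMangoldt k * ((N : ℝ) / k) := by ring
      _ ≤ vonMangoldt k * (((N / k : ℕ) : ℝ) + 1) :=
          mul_le_mul_of_nonneg_left this vonMangoldt_nonneg
      _ = _ := by ring
  have h2 : ∑ k ∈ Finset.Ioc 0 N, vonMangoldt k ≤ (Real.log 4 + 4) * N := by
    have := Chebyshev.psi_le_const_mul_self hN0.le
    simpa [Chebyshev.psi] using this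
  have h3 : Real.log (N.factorial : ℝ) ≤ N * Real.log N := by
    rw [← Real.log_pow]
    refine Real.log_le_log (by positivity) ?_
    exact_mod_cast Nat.factorial_le_pow N
  have : N * ∑ k ∈ Finset.Ioc 0 N, vonMangoldt k / k ≤ N * (Real.log N + (Real.log 4 + 4)) := by
    linarith
  exact le_of_mul_le_mul_left this hN0

open ArithmeticFunction in
theorem aux_weighted (s : ℝ) (hs : 0 < s) (N : ℕ) (hN : 1 ≤ N) :
    ((N : ℝ) ^ s - 1) / s +
      (∑ k ∈ Finset.Ioc 0 N, vonMangoldt k / k - Real.log N - (Real.log 4 + 4)) * (N : ℝ) ^ s ≤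
    ∑ k ∈ Finset.Ioc 0 N, vonMangoldt k / k * (k : ℝ) ^ s := by
  induction N, hN using Nat.le_induction with
  | base =>
    have : 0 < Real.log 4 := Real.log_pos (by norm_num)
    simp; linarith
  | succ n hn ih =>
    rw [Finset.sum_Ioc_succ_top (by omega), Finset.sum_Ioc_succ_top (by omega)]
    have hU := aux_mertens_upper n hn
    have hn0 : (0 : ℝ) < n := by exact_mod_cast hn
    have hg : (n : ℝ) ^ s ≤ ((n + 1 : ℕ) : ℝ) ^ s :=
      Real.rpow_le_rpow hn0.le (by push_cast; linarith) hs.le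
    have hkey : (((n + 1 : ℕ) : ℝ) ^ s - (n : ℝ) ^ s) / s ≤
        (Real.log ((n + 1 : ℕ) : ℝ) - Real.log n) * ((n + 1 : ℕ) : ℝ) ^ s := by
      rw [div_le_iff₀ hs]
      have hn1 : (0 : ℝ) < ((n + 1 : ℕ) : ℝ) := by positivity
      rw [Real.rpow_def_of_pos hn1, Real.rpow_def_of_pos hn0]
      set a := Real.log ((n + 1 : ℕ) : ℝ)
      set b := Real.log (n : ℝ)
      have h1 : Real.exp (b * s) = Real.exp (a * s) * Real.exp (b * s - a * s) := by
        rw [← Real.exp_add]; ring_nf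
      have h2 := Real.add_one_le_exp (b * s - a * s)
      rw [h1]
      nlinarith [Real.exp_pos (a * s), mul_le_mul_of_nonneg_left h2 (Real.exp_pos (a * s)).le]
    set g' := ((n + 1 : ℕ) : ℝ) ^ s
    set g := (n : ℝ) ^ s
    set A := ∑ k ∈ Finset.Ioc 0 n, vonMangoldt k / k
    have e : (g' - 1) / s = (g - 1) / s + (g' - g) / s := by ring
    rw [e]
    nlinarith [mul_nonneg (sub_nonneg.2 hg) (sub_nonneg.2 hU)]

open ArithmeticFunction in
theorem aux_T_lower (s : ℝ) (hs : 0 < s) (N : ℕ) (hN : 1 ≤ N) :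
    ((N : ℝ) ^ s - 1) / s - (Real.log 4 + 5) * (N : ℝ) ^ s ≤
    ∑ k ∈ Finset.Ioc 0 N, vonMangoldt k / k * (k : ℝ) ^ s := by
  have h1 := aux_weighted s hs N hN
  have h2 := aux_mertens_lower N hN
  have h3 : 0 ≤ (N : ℝ) ^ s := by positivity
  nlinarith [mul_le_mul_of_nonneg_right h2 h3]

open ArithmeticFunction Classical in
theorem aux_count_step (P : ℕ → Prop) (hmul : ∀ a b, P a → P b → P (a * b)) (N m : ℕ)
    (hP : ∀ n, 1 ≤ n → n ≤ N → P n) (hm : 1 ≤ m) (hNm : N ≤ m) :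
    ∑ k ∈ Finset.Ioc 0 N, vonMangoldt k * (((Finset.Ioc 0 (m / k)).filter P).card : ℝ) ≤
      Real.log m * (((Finset.Ioc 0 m).filter P).card : ℝ) := by
  have h1 : ∑ n ∈ (Finset.Ioc 0 m).filter P, Real.log n ≤
      Real.log m * (((Finset.Ioc 0 m).filter P).card : ℝ) := by
    rw [mul_comm, ← nsmul_eq_mul]
    refine Finset.sum_le_card_nsmul _ _ _ fun n hn => ?_
    simp only [Finset.mem_filter, Finset.mem_Ioc] at hn
    exact Real.log_le_log (by exact_mod_cast hn.1.1) (by exact_mod_cast hn.1.2)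
  refine le_trans ?_ h1
  have h2 : ∀ n ∈ (Finset.Ioc 0 m).filter P, Real.log n =
      ∑ k ∈ Finset.Ioc 0 m, if k ∣ n then vonMangoldt k else 0 := by
    intro n hn
    simp only [Finset.mem_filter, Finset.mem_Ioc] at hn
    rw [← vonMangoldt_sum, ← Finset.sum_filter]
    refine Finset.sum_congr ?_ fun _ _ => rfl
    ext k
    simp only [Nat.mem_divisors, Finset.mem_filter, Finset.mem_Ioc]
    constructor
    · rintro ⟨h, h0⟩
      exact ⟨⟨Nat.pos_of_dvd_of_pos h hn.1.1, (Nat.le_of_dvd hn.1.1 h).trans hn.1.2⟩, h⟩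
    · rintro ⟨h, h0⟩
      exact ⟨h0, by omega⟩
  rw [Finset.sum_congr rfl h2, Finset.sum_comm]
  refine le_trans ?_ (Finset.sum_le_sum_of_subset_of_nonneg
    (Finset.Ioc_subset_Ioc_right hNm) ?_)
  · refine Finset.sum_le_sum fun k hk => ?_
    rw [Finset.mem_Ioc] at hk
    rw [← Finset.sum_filter, Finset.sum_const, nsmul_eq_mul, mul_comm]
    refine mul_le_mul_of_nonneg_right ?_ vonMangoldt_nonneg
    norm_cast
    refine Finset.card_le_card_of_injOn (fun j => k * j) ?_ ?_
    · intro j hj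
      simp only [Finset.coe_filter, Finset.mem_Ioc, Set.mem_ofPred_eq, Finset.mem_filter] at hj ⊢
      refine ⟨⟨⟨Nat.mul_pos hk.1 hj.1.1, ?_⟩, hmul _ _ (hP k hk.1 hk.2) hj.2⟩, dvd_mul_right _ _⟩
      calc k * j ≤ k * (m / k) := Nat.mul_le_mul_left _ hj.1.2
        _ ≤ m := Nat.mul_div_le m k
    · intro a _ b _ h
      exact Nat.eq_of_mul_eq_mul_left hk.1 h
  · intro k _ _
    refine Finset.sum_nonneg fun n _ => ?_
    split_ifs
    · exact vonMangoldt_nonneg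
    · exact le_rfl

open ArithmeticFunction Classical in
theorem aux_count (P : ℕ → Prop) (hmul : ∀ a b, P a → P b → P (a * b)) (N X : ℕ)
    (hP : ∀ n, 1 ≤ n → n ≤ N → P n) (hN : 1 ≤ N) (s : ℝ) (hs0 : 0 ≤ s) (hs1 : s ≤ 1)
    (hT : Real.log X ≤ ∑ k ∈ Finset.Ioc 0 N, vonMangoldt k / k * (k : ℝ) ^ s) (m : ℕ) :
    1 ≤ m → m ≤ X →
    1 / 2 * ((m : ℝ) + 1) ^ (1 - s) ≤ (((Finset.Ioc 0 m).filter P).card : ℝ) := by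
  induction m using Nat.strong_induction_on with
  | _ m ih =>
  intro hm hmX
  have hm' : (1 : ℝ) ≤ m := by exact_mod_cast hm
  by_cases hmN : m ≤ N
  · have : (Finset.Ioc 0 m).filter P = Finset.Ioc 0 m := by
      rw [Finset.filter_eq_self]
      intro n hn
      rw [Finset.mem_Ioc] at hn
      exact hP n hn.1 (hn.2.trans hmN)
    rw [this, Nat.card_Ioc, Nat.sub_zero]
    have : ((m : ℝ) + 1) ^ (1 - s) ≤ ((m : ℝ) + 1) ^ (1 : ℝ) :=
      Real.rpow_le_rpow_of_exponent_le (by linarith) (by linarith)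
    rw [Real.rpow_one] at this
    linarith
  · push Not at hmN
    have hstep := aux_count_step P hmul N m hP hm hmN.le
    have hlogm : 0 < Real.log m := Real.log_pos (by exact_mod_cast (by omega : 1 < m))
    have hlog : Real.log m ≤ Real.log X :=
      Real.log_le_log (by positivity) (by exact_mod_cast hmX)
    have hpos : 0 ≤ 1 / 2 * ((m : ℝ) + 1) ^ (1 - s) := by positivity
    have hlow : (1 / 2 * ((m : ℝ) + 1) ^ (1 - s)) *
        ∑ k ∈ Finset.Ioc 0 N, vonMangoldt k / k * (k : ℝ) ^ s ≤
        ∑ k ∈ Finset.Ioc 0 N, vonMangoldt k * (((Finset.Ioc 0 (m / k)).filter P).card : ℝ) := by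
      rw [Finset.mul_sum]
      refine Finset.sum_le_sum fun k hk => ?_
      rw [Finset.mem_Ioc] at hk
      by_cases hk1 : k = 1
      · subst hk1; simp
      have hk0 : (0 : ℝ) < k := by exact_mod_cast hk.1
      have hi := ih (m / k) (Nat.div_lt_self (by omega) (by omega))
        (Nat.div_pos (by omega) hk.1) ((Nat.div_le_self _ _).trans hmX)
      have hle : ((m : ℝ) + 1) / k ≤ ((m / k : ℕ) : ℝ) + 1 := by
        rw [div_le_iff₀ hk0]
        have := Nat.lt_div_mul_add hk.1 (a := m)
        have h2 : m + 1 ≤ (m / k + 1) * k := by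
          rw [add_mul]; omega
        exact_mod_cast h2
      have hr : (((m : ℝ) + 1) / k) ^ (1 - s) ≤ (((m / k : ℕ) : ℝ) + 1) ^ (1 - s) :=
        Real.rpow_le_rpow (by positivity) hle (by linarith)
      have he : (((m : ℝ) + 1) / k) ^ (1 - s) = ((m : ℝ) + 1) ^ (1 - s) * ((k : ℝ) ^ s / k) := by
        rw [Real.div_rpow (by positivity) hk0.le, Real.rpow_sub hk0, Real.rpow_one]
        field_simp
      calc _ = vonMangoldt k * (1 / 2 * (((m : ℝ) + 1) / k) ^ (1 - s)) := by rw [he]; ring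
        _ ≤ _ := mul_le_mul_of_nonneg_left (by linarith) vonMangoldt_nonneg
    have hfin : Real.log m * (1 / 2 * ((m : ℝ) + 1) ^ (1 - s)) ≤
        Real.log m * (((Finset.Ioc 0 m).filter P).card : ℝ) := by
      refine le_trans ?_ (hlow.trans hstep)
      rw [mul_comm]
      exact mul_le_mul_of_nonneg_left (hlog.trans hT) hpos
    exact le_of_mul_le_mul_left hfin hlogm

open Classical in
theorem aux_kernel_card (q : ℕ) (hq : q.Prime) (χ : DirichletCharacter ℂ q) :
    ((Finset.Ioc 0 q).filter (fun n : ℕ => χ (n : ZMod q) = 1)).card * orderOf χ ≤ q - 1 := by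
  haveI : Fact q.Prime := ⟨hq⟩
  set f := MulChar.toUnitHom χ with hf
  have h1 : Nat.card f.ker * Nat.card f.range = q - 1 := by
    rw [← Subgroup.index_ker f, Subgroup.card_mul_index, Nat.card_eq_fintype_card,
      ZMod.card_units]
  have hcr : 0 < Nat.card f.range := by
    by_contra h
    have := hq.two_le
    rw [Nat.eq_zero_of_not_pos h] at h1
    omega
  have h2 : orderOf χ ≤ Nat.card f.range := by
    refine Nat.le_of_dvd hcr (orderOf_dvd_of_pow_eq_one ?_)
    ext a
    rw [MulChar.pow_apply_coe, MulChar.one_apply_coe]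
    have h3 : (⟨f a, ⟨a, rfl⟩⟩ : f.range) ^ Nat.card f.range = 1 := pow_card_eq_one'
    have h4 : (f a) ^ Nat.card f.range = 1 := by
      simpa using congrArg Subtype.val h3
    have h5 := congrArg Units.val h4
    rw [Units.val_pow_eq_pow_val, MulChar.coe_toUnitHom] at h5
    simpa using h5
  have h3 : ((Finset.Ioc 0 q).filter (fun n : ℕ => χ (n : ZMod q) = 1)).card ≤
      Nat.card f.ker := by
    rw [Nat.card_eq_fintype_card, ← Finset.card_univ]
    have hunit : ∀ n ∈ (Finset.Ioc 0 q).filter (fun n : ℕ => χ (n : ZMod q) = 1),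
        IsUnit (n : ZMod q) := by
      intro n hn
      by_contra h
      have := MulChar.map_nonunit χ h
      rw [(Finset.mem_filter.1 hn).2] at this
      exact one_ne_zero this
    refine Finset.card_le_card_of_injOn
      (fun n => if h : n ∈ (Finset.Ioc 0 q).filter (fun n : ℕ => χ (n : ZMod q) = 1) then
        ⟨(hunit n h).unit, by
          rw [MonoidHom.mem_ker]
          ext
          rw [MulChar.coe_toUnitHom]
          simpa using (Finset.mem_filter.1 h).2⟩ else 1) ?_ ?_
    · intro n _
      simp
    · intro a ha b hb hab
      have ha' := Finset.mem_coe.1 ha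
      have hb' := Finset.mem_coe.1 hb
      simp only [dif_pos ha', dif_pos hb'] at hab
      have h5 : ((a : ZMod q)) = (b : ZMod q) := by
        have := congrArg Units.val (congrArg Subtype.val hab)
        simpa using this
      rw [ZMod.natCast_eq_natCast_iff'] at h5
      have hlt : ∀ n ∈ (Finset.Ioc 0 q).filter (fun n : ℕ => χ (n : ZMod q) = 1), n < q := by
        intro n hn
        have h6 := Finset.mem_Ioc.1 (Finset.mem_filter.1 hn).1
        rcases h6.2.lt_or_eq with h | h
        · exact h
        · have := hunit n hn
          rw [h] at this
          simp at this
      rwa [Nat.mod_eq_of_lt (hlt a ha'), Nat.mod_eq_of_lt (hlt b hb')] at h5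
  calc _ ≤ Nat.card f.ker * Nat.card f.range := Nat.mul_le_mul h3 h2
    _ = _ := h1

theorem aux_log_le (x : ℝ) (hx : 0 < x) : Real.log x ≤ 9 + x / 1000 := by
  have h1 := Real.log_le_sub_one_of_pos (x := x / Real.exp 10) (by positivity)
  rw [Real.log_div hx.ne' (Real.exp_pos _).ne', Real.log_exp] at h1
  have h2 : (1000 : ℝ) ≤ Real.exp 10 := by
    have : Real.exp 10 = Real.exp 1 ^ 10 := by rw [← Real.exp_nat_mul]; norm_num
    rw [this]
    calc (1000 : ℝ) ≤ 2 ^ 10 := by norm_num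
      _ ≤ _ := pow_le_pow_left₀ (by norm_num) (by linarith [Real.exp_one_gt_d9]) _
  have h3 : x / Real.exp 10 ≤ x / 1000 := by gcongr
  linarith

theorem aux_numeric (D E : ℝ) (hD : 1.09 ≤ D) (hE : E = 100000 + D + Real.log D) :
    D + 3 / 10 < Real.exp ((D - 7 / 10) * (Real.log E / D)) := by
  have hl : 0 ≤ Real.log D := Real.log_nonneg (by linarith)
  have hD0 : 0 < D := by linarith
  have hE0 : 100000 ≤ E := by linarith
  have hEp : 0 < E := by linarith
  have hL : 10 ≤ Real.log E := by
    rw [Real.le_log_iff_exp_le hEp]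
    have : Real.exp 10 = Real.exp 1 ^ 10 := by rw [← Real.exp_nat_mul]; norm_num
    rw [this]
    calc _ ≤ (2.72 : ℝ) ^ 10 :=
          pow_le_pow_left₀ (Real.exp_pos _).le (by linarith [Real.exp_one_lt_d9]) _
      _ ≤ 100000 := by norm_num
      _ ≤ E := hE0
  have hlogE := Real.exp_log hEp
  set L := Real.log E with hLdef
  by_cases hDL : D < L
  · have h1 : 0.35 * L ≤ (D - 7 / 10) * (L / D) := by
      rw [mul_div_assoc', le_div_iff₀ hD0]
      nlinarith
    have h2 := Real.quadratic_le_exp_of_nonneg (x := 0.35 * L) (by linarith)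
    have h3 := Real.exp_le_exp.2 h1
    nlinarith
  push Not at hDL
  have he : Real.exp ((D - 7 / 10) * (L / D)) = E * Real.exp (-(7 / 10 * (L / D))) := by
    rw [← hlogE, ← Real.exp_add]
    congr 1
    field_simp
    ring
  rw [he]
  have hη : L / D ≤ 1 := by rw [div_le_one hD0]; exact hDL
  have hlow := Real.add_one_le_exp (-(7 / 10 * (L / D)))
  by_cases hc : D ≤ E / 4
  · have : (0.3 : ℝ) ≤ Real.exp (-(7 / 10 * (L / D))) := by linarith
    nlinarith
  push Not at hc
  have h4 : E * (-(7 / 10 * (L / D)) + 1) ≤ E * Real.exp (-(7 / 10 * (L / D))) :=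
    mul_le_mul_of_nonneg_left hlow hEp.le
  refine lt_of_lt_of_le ?_ h4
  have e1 : E * (-(7 / 10 * (L / D)) + 1) = E - 7 / 10 * L * (E / D) := by ring
  rw [e1]
  by_cases h2b : 3.5 * (100000 + Real.log D) < D
  · have h5 : E / D ≤ 9 / 7 := by rw [div_le_iff₀ hD0]; linarith
    have h6 : L ≤ Real.log D + 2 / 7 := by
      have : L ≤ Real.log (9 / 7 * D) :=
        Real.log_le_log hEp (by rw [div_le_iff₀ hD0] at h5; exact h5)
      rw [Real.log_mul (by norm_num) hD0.ne'] at this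
      have := Real.log_le_sub_one_of_pos (x := (9 / 7 : ℝ)) (by norm_num)
      linarith
    have h7 : 7 / 10 * L * (E / D) ≤ 7 / 10 * L * (9 / 7) :=
      mul_le_mul_of_nonneg_left h5 (by linarith)
    linarith
  · push Not at h2b
    have h5 : E / D ≤ 4 := by rw [div_le_iff₀ hD0]; linarith
    have h6 := aux_log_le E hEp
    have h7 : 7 / 10 * L * (E / D) ≤ 7 / 10 * L * 4 :=
      mul_le_mul_of_nonneg_left h5 (by linarith)
    linarith

open Filter Topology in
theorem aux_eventually (μ δ K : ℝ) (hμ : 0 < μ) (h : μ + 1 < Real.exp (μ * δ)) :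
    ∀ᶠ Q : ℝ in atTop, Q ≤ Q * (Real.exp (μ * δ - μ * Real.log 2 / Q) - 1) / μ
      - K * Real.exp (μ * δ) := by
  have h1 : Tendsto (fun Q : ℝ => Real.exp (μ * δ - μ * Real.log 2 / Q) - 1
      - K * μ * Real.exp (μ * δ) / Q) atTop (𝓝 (Real.exp (μ * δ - 0) - 1 - 0)) := by
    refine Tendsto.sub (Tendsto.sub ?_ tendsto_const_nhds) (tendsto_const_nhds.div_atTop tendsto_id)
    exact (Real.continuous_exp.tendsto _).comp
      (tendsto_const_nhds.sub (tendsto_const_nhds.div_atTop tendsto_id))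
  have h2 := h1.eventually (lt_mem_nhds (a := μ) (by simp; linarith))
  filter_upwards [h2, eventually_gt_atTop 0] with Q hQ hQ0
  have h3 : Q * μ ≤ Q * (Real.exp (μ * δ - μ * Real.log 2 / Q) - 1
      - K * μ * Real.exp (μ * δ) / Q) := mul_le_mul_of_nonneg_left hQ.le hQ0.le
  have h4 : Q = Q * μ / μ := by field_simp
  calc Q = Q * μ / μ := h4
    _ ≤ Q * (Real.exp (μ * δ - μ * Real.log 2 / Q) - 1
      - K * μ * Real.exp (μ * δ) / Q) / μ := by gcongr
    _ = _ := by field_simp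

theorem least_nonone_value_of_large_order_character :
    ∃ C : ℝ, 0 < C ∧ ∀ d : ℕ, 3 ≤ d → ∃ q₀ : ℕ, ∀ q : ℕ, q.Prime → q₀ ≤ q →
      d ∣ (q - 1) →
      ∀ χ : DirichletCharacter ℂ q, χ.IsPrimitive → orderOf χ = d →
      ∃ n : ℕ, 1 ≤ n ∧
        (n : ℝ) ≤ (q : ℝ) ^ (Real.log (Real.log (C * d * Real.log d)) / Real.log d) ∧
        χ (n : ZMod q) ≠ 1 := by
  classical
  refine ⟨Real.exp 100000, Real.exp_pos _, fun d hd => ?_⟩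
  have hd3 : (3 : ℝ) ≤ d := by exact_mod_cast hd
  have hD : 1.09 ≤ Real.log d := by
    have h1 : Real.log 3 ≤ Real.log d := Real.log_le_log (by norm_num) hd3
    have h2 : (1.09 : ℝ) ≤ Real.log 3 := by
      rw [Real.le_log_iff_exp_le (by norm_num)]
      have h3 : Real.exp 1.09 = Real.exp 1 * Real.exp 0.09 := by
        rw [← Real.exp_add]; norm_num
      have h4 : Real.exp 0.09 ≤ 1 / (1 - 0.09) :=
        Real.exp_bound_div_one_sub_of_interval (by norm_num) (by norm_num)
      rw [h3]
      have := Real.exp_one_lt_d9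
      nlinarith [Real.exp_pos 1, Real.exp_pos 0.09]
    linarith
  have hE : Real.log (Real.exp 100000 * d * Real.log d) =
      100000 + Real.log d + Real.log (Real.log d) := by
    rw [Real.log_mul (by positivity) (by linarith), Real.log_mul (by positivity) (by positivity),
      Real.log_exp]
  have hnum := aux_numeric (Real.log d) _ hD hE
  have hdexp : Real.exp (Real.log d) = d := Real.exp_log (by linarith)
  set D := Real.log d with hDdef
  set δ := Real.log (Real.log (Real.exp 100000 * d * D)) / D with hδdef
  set μ := D - 7 / 10 with hμdef
  have hμ : 0 < μ := by linarith
  have hδ : 0 < δ := by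
    have : 0 < μ * δ := by
      rw [← Real.exp_lt_exp, Real.exp_zero]; linarith
    exact (pos_iff_pos_of_mul_pos this).1 hμ
  have hev := aux_eventually μ δ (Real.log 4 + 5) hμ (by linarith)
  have hev2 := (Real.tendsto_log_atTop.comp tendsto_natCast_atTop_atTop).eventually
    (hev.and (Filter.eventually_ge_atTop (max μ 1)))
  obtain ⟨q₀, hq₀⟩ := Filter.eventually_atTop.1 hev2
  refine ⟨q₀, fun q hq hqq _ χ _ hord => ?_⟩
  obtain ⟨hQ, hQ2⟩ := hq₀ q hqq
  simp only [Function.comp] at hQ hQ2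
  have hq0 : (0 : ℝ) < q := by exact_mod_cast hq.pos
  have hq1 : (1 : ℝ) ≤ q := by exact_mod_cast hq.one_le
  have hQexp : Real.exp (Real.log q) = q := Real.exp_log hq0
  set Q := Real.log q with hQdef
  have hQμ : μ ≤ Q := (le_max_left _ _).trans hQ2
  have hQ1 : 1 ≤ Q := (le_max_right _ _).trans hQ2
  by_contra hcon
  push Not at hcon
  set N := ⌊(q : ℝ) ^ δ⌋₊ with hNdef
  have hqδ : 1 ≤ (q : ℝ) ^ δ := Real.one_le_rpow hq1 hδ.le
  have hN1 : 1 ≤ N := Nat.one_le_floor_iff _ |>.2 hqδ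
  have hN1' : (1 : ℝ) ≤ N := by exact_mod_cast hN1
  have hNle : (N : ℝ) ≤ (q : ℝ) ^ δ := Nat.floor_le (by linarith)
  have hNge : (q : ℝ) ^ δ ≤ 2 * N := by
    have := (Nat.lt_floor_add_one ((q : ℝ) ^ δ)).le
    linarith
  have hP : ∀ n, 1 ≤ n → n ≤ N → χ (n : ZMod q) = 1 := fun n h1 h2 =>
    hcon n h1 (le_trans (by exact_mod_cast h2) hNle)
  set s := μ / Q with hs
  have hs0 : 0 < s := by positivity
  have hs1 : s ≤ 1 := by rw [hs, div_le_one (by linarith)]; exact hQμ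
  have hlogN1 : Real.log N ≤ Q * δ := by
    have := Real.log_le_log (by linarith) hNle
    rwa [Real.log_rpow hq0, mul_comm] at this
  have hlogN2 : Q * δ - Real.log 2 ≤ Real.log N := by
    have := Real.log_le_log (by linarith) hNge
    rw [Real.log_rpow hq0, Real.log_mul (by norm_num) (by linarith)] at this
    linarith
  have hNs : (N : ℝ) ^ s = Real.exp (Real.log N * s) := Real.rpow_def_of_pos (by linarith) _
  have hsQ : Q * s = μ := by rw [hs]; field_simp
  have hNs1 : (N : ℝ) ^ s ≤ Real.exp (μ * δ) := by
    rw [hNs, Real.exp_le_exp]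
    calc _ ≤ Q * δ * s := by gcongr
      _ = (Q * s) * δ := by ring
      _ = _ := by rw [hsQ]
  have hNs2 : Real.exp (μ * δ - μ * Real.log 2 / Q) ≤ (N : ℝ) ^ s := by
    rw [hNs, Real.exp_le_exp]
    calc _ = (Q * s) * δ - Real.log 2 * s := by rw [hsQ, hs]; ring
      _ = (Q * δ - Real.log 2) * s := by ring
      _ ≤ _ := by gcongr
  have hT := aux_T_lower s hs0 N hN1
  have hK : 0 < Real.log 4 + 5 := by
    have : 0 < Real.log 4 := Real.log_pos (by norm_num)
    linarith
  have hlogq : Real.log q ≤ ∑ k ∈ Finset.Ioc 0 N,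
      ArithmeticFunction.vonMangoldt k / k * (k : ℝ) ^ s := by
    refine le_trans ?_ hT
    refine le_trans hQ ?_
    have a1 : Q * (Real.exp (μ * δ - μ * Real.log 2 / Q) - 1) / μ ≤ ((N : ℝ) ^ s - 1) / s := by
      have : ((N : ℝ) ^ s - 1) / s = Q * ((N : ℝ) ^ s - 1) / μ := by
        rw [hs]; field_simp
      rw [this]
      gcongr
    have a2 : (Real.log 4 + 5) * (N : ℝ) ^ s ≤ (Real.log 4 + 5) * Real.exp (μ * δ) := by gcongr
    linarith
  have hcount := aux_count (fun n : ℕ => χ (n : ZMod q) = 1)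
    (fun a b ha hb => by
      rw [Nat.cast_mul, map_mul, ha, hb, one_mul]) N q hP hN1 s hs0.le hs1 hlogq q hq.one_le le_rfl
  have hker := aux_kernel_card q hq χ
  rw [hord] at hker
  have hker' : (((Finset.Ioc 0 q).filter (fun n : ℕ => χ (n : ZMod q) = 1)).card : ℝ) * d ≤ q := by
    have := hker.trans (Nat.sub_le q 1)
    exact_mod_cast this
  have b1 : (q : ℝ) ^ (1 - s) ≤ ((q : ℝ) + 1) ^ (1 - s) :=
    Real.rpow_le_rpow hq0.le (by linarith) (by linarith)
  have b2 : (q : ℝ) ^ (1 - s) * Real.exp μ = q := by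
    have : Real.exp μ = (q : ℝ) ^ s := by
      rw [Real.rpow_def_of_pos hq0, ← hQdef, hsQ]
    rw [this, ← Real.rpow_add hq0]
    simp
  have b3 : Real.exp μ * 2 < d := by
    have h1 : Real.exp μ * Real.exp (7 / 10) = d := by
      rw [← Real.exp_add, ← hdexp]; congr 1; rw [hμdef]; ring
    have h2 : (2 : ℝ) < Real.exp (7 / 10) := by
      rw [← Real.log_lt_iff_lt_exp (by norm_num)]
      linarith [Real.log_two_lt_d9]
    rw [← h1]
    exact mul_lt_mul_of_pos_left h2 (Real.exp_pos _)
  have b4 : 0 < (q : ℝ) ^ (1 - s) := by positivity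
  have b5 : 1 / 2 * (q : ℝ) ^ (1 - s) * d ≤ q := by
    refine le_trans ?_ hker'
    refine mul_le_mul_of_nonneg_right ?_ (by linarith)
    linarith
  nlinarith [mul_lt_mul_of_pos_left b3 b4]
end

section
/- For every δ ∈ (0,1) there exist a constant c = c(δ) ∈ (0,1) and a threshold q₀ = q₀(δ) such that for all primes q ≥ q₀ and all integers 0 ≤ d₁ ≤ d₂ ≤ c·q: if n^{d₂} ≡ n^{d₁} (mod q) for every integer 1 ≤ n ≤ q^δ, then d₁ = d₂. -/
open Finset

lemma aux_log_factorial_s14 (n : ℕ) : Real.log (n.factorial : ℝ) =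
    ∑ p ∈ n.primesLE, (n.factorial.factorization p : ℝ) * Real.log p := by
  have h0 : n.factorial ≠ 0 := Nat.factorial_ne_zero n
  have hs : n.factorial.primeFactors ⊆ n.primesLE := by
    intro p hp
    have hpp := Nat.prime_of_mem_primeFactors hp
    rw [Nat.mem_primesLE]
    exact ⟨(hpp.dvd_factorial).1 (Nat.dvd_of_mem_primeFactors hp), hpp⟩
  have h1 : n.factorial = ∏ p ∈ n.primesLE, p ^ n.factorial.factorization p := by
    conv_lhs => rw [← Nat.prod_factorization_pow_eq_self h0]
    rw [Nat.prod_factorization_eq_prod_primeFactors]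
    apply Finset.prod_subset hs
    intro p _ hp
    rw [← Nat.support_factorization, Finsupp.notMem_support_iff] at hp
    simp [hp]
  conv_lhs => rw [h1]
  rw [Nat.cast_prod, Real.log_prod]
  · simp
  · intro p hp
    have := (Nat.prime_of_mem_primesLE hp).pos
    positivity

lemma aux_upper (n : ℕ) (hn : 1 ≤ n) :
    ∑ p ∈ n.primesLE, Real.log p / p ≤ Real.log n + Real.log 4 := by
  have hn0 : (0:ℝ) < n := by exact_mod_cast hn
  have h1 : Real.log (n.factorial : ℝ) ≤ n * Real.log n := by
    rw [← Real.log_pow]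
    apply Real.log_le_log (by exact_mod_cast n.factorial_pos)
    exact_mod_cast Nat.factorial_le_pow n
  have h2 : ∑ p ∈ n.primesLE, ((n:ℝ) / p - 1) * Real.log p ≤ Real.log (n.factorial : ℝ) := by
    rw [aux_log_factorial_s14]
    apply Finset.sum_le_sum
    intro p hp
    have hpp := Nat.prime_of_mem_primesLE hp
    have hlog : 0 ≤ Real.log p := Real.log_natCast_nonneg p
    apply mul_le_mul_of_nonneg_right _ hlog
    have hdvd : p ^ (n / p) ∣ n.factorial := by
      have h := Nat.factorial_dvd_factorial (Nat.mul_div_le n p)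
      refine dvd_trans ?_ h
      have : ∀ k, p ^ k ∣ (p * k).factorial := by
        intro k
        induction k with
        | zero => simp
        | succ k ih =>
          rw [pow_succ]
          have e : p * (k+1) = (p * k + p - 1) + 1 := by have := hpp.pos; rw [mul_add]; omega
          rw [e, Nat.factorial_succ, mul_comm]
          apply mul_dvd_mul
          · rw [← e]; exact Dvd.intro _ rfl
          · exact ih.trans (Nat.factorial_dvd_factorial (by have := hpp.pos; omega))
      exact this _
    have hle := (hpp.pow_dvd_iff_le_factorization (Nat.factorial_ne_zero n)).1 hdvd
    have h3 : (n:ℝ) / p < (n / p : ℕ) + 1 := by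
      have := Nat.lt_floor_add_one ((n:ℝ) / p)
      rwa [Nat.floor_div_natCast, Nat.floor_natCast] at this
    have h4 : ((n / p : ℕ) : ℝ) ≤ n.factorial.factorization p := by exact_mod_cast hle
    linarith
  have h3 : ∑ p ∈ n.primesLE, Real.log p ≤ Real.log 4 * n := by
    rw [← Chebyshev.theta_eq_sum_primesLE_log]
    exact Chebyshev.theta_le_log4_mul_x hn0.le
  have h4 : ∑ p ∈ n.primesLE, ((n:ℝ) / p - 1) * Real.log p =
      n * ∑ p ∈ n.primesLE, Real.log p / p - ∑ p ∈ n.primesLE, Real.log p := by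
    rw [Finset.mul_sum, ← Finset.sum_sub_distrib]
    apply Finset.sum_congr rfl
    intros; ring
  have : n * ∑ p ∈ n.primesLE, Real.log p / p ≤ n * (Real.log n + Real.log 4) := by
    linarith
  exact le_of_mul_le_mul_left this hn0

lemma aux_lower : ∃ C : ℝ, 0 ≤ C ∧ ∀ n : ℕ, 1 ≤ n →
    Real.log n - C ≤ ∑ p ∈ n.primesLE, Real.log p / p := by
  have hsum : Summable (fun k : ℕ => 4 * (1 / (k:ℝ) ^ (3/2 : ℝ))) :=
    (Real.summable_one_div_nat_rpow.2 (by norm_num)).mul_left 4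
  refine ⟨1 + ∑' k : ℕ, 4 * (1 / (k:ℝ) ^ (3/2 : ℝ)), ?_, ?_⟩
  · have : 0 ≤ ∑' k : ℕ, 4 * (1 / (k:ℝ) ^ (3/2 : ℝ)) := tsum_nonneg fun k => by positivity
    linarith
  intro n hn
  have hn0 : (0:ℝ) < n := by exact_mod_cast hn
  have h1 : n * Real.log n - n ≤ Real.log (n.factorial : ℝ) := by
    have h := Real.pow_div_factorial_le_exp (n:ℝ) hn0.le n
    have hf : (0:ℝ) < n.factorial := by exact_mod_cast n.factorial_pos
    have h' := Real.log_le_log (by positivity) h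
    rw [Real.log_exp, Real.log_div (by positivity) (by positivity), Real.log_pow] at h'
    linarith
  have h2 : Real.log (n.factorial : ℝ) ≤
      n * ∑ p ∈ n.primesLE, (Real.log p / p + 4 * (1 / (p:ℝ) ^ (3/2 : ℝ))) := by
    rw [aux_log_factorial_s14, Finset.mul_sum]
    apply Finset.sum_le_sum
    intro p hp
    have hpp := Nat.prime_of_mem_primesLE hp
    have hlog : 0 ≤ Real.log p := Real.log_natCast_nonneg p
    have hp2 : (2:ℝ) ≤ p := by exact_mod_cast hpp.two_le
    have hv : (n.factorial.factorization p : ℝ) ≤ n / (p - 1) := by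
      have : Fact p.Prime := ⟨hpp⟩
      have h := sub_one_mul_padicValNat_factorial_lt_of_ne_zero (p := p) (n := n) (by omega)
      rw [le_div_iff₀ (by linarith), Nat.factorization_def _ hpp]
      have h' : (((p - 1) * padicValNat p n.factorial : ℕ) : ℝ) ≤ n := by exact_mod_cast h.le
      rw [Nat.cast_mul, Nat.cast_sub hpp.one_le] at h'
      push_cast at h'
      linarith
    have hl : Real.log p ≤ 2 * (p:ℝ) ^ (1/2 : ℝ) := by
      have := Real.log_le_rpow_div (x := (p:ℝ)) (by linarith) (ε := 1/2) (by norm_num)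
      linarith
    have hpow : (p:ℝ) ^ (1/2 : ℝ) / p ^ 2 = 1 / (p:ℝ) ^ (3/2 : ℝ) := by
      rw [div_eq_div_iff (by positivity) (by positivity), ← Real.rpow_add (by linarith), one_mul,
        ← Real.rpow_natCast]
      norm_num
    have hk : Real.log p / (p - 1) ≤ Real.log p / p + 4 * (1 / (p:ℝ) ^ (3/2 : ℝ)) := by
      have e : Real.log p / (p - 1) - Real.log p / p = Real.log p / (p * (p - 1)) := by
        have : (p:ℝ) - 1 ≠ 0 := by linarith
        field_simp
        ring
      have e2 : Real.log p / (p * (p - 1)) ≤ (2 * (p:ℝ) ^ (1/2 : ℝ)) / (p ^ 2 / 2) := by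
        apply div_le_div₀ (by positivity) hl (by positivity)
        nlinarith
      have e3 : (2 * (p:ℝ) ^ (1/2 : ℝ)) / (p ^ 2 / 2) = 4 * (1 / (p:ℝ) ^ (3/2 : ℝ)) := by
        rw [← hpow]; ring
      linarith
    calc (n.factorial.factorization p : ℝ) * Real.log p ≤ n / (p - 1) * Real.log p := by gcongr
      _ = n * (Real.log p / (p - 1)) := by ring
      _ ≤ _ := by gcongr
  rw [Finset.sum_add_distrib] at h2
  have h3 := hsum.sum_le_tsum n.primesLE (fun k _ => by positivity)
  have h4 : n * (Real.log n - 1) ≤ n * (∑ p ∈ n.primesLE, Real.log p / p +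
      ∑ p ∈ n.primesLE, 4 * (1 / (p:ℝ) ^ (3/2 : ℝ))) := by linarith
  have h5 := le_of_mul_le_mul_left h4 hn0
  linarith

/-- Sum of reciprocals of primes in an interval. -/
lemma aux_interval : ∃ C : ℝ, 0 ≤ C ∧ ∀ Y Z : ℝ, 2 ≤ Z → Z ≤ Y →
    Real.log Y - Real.log Z - C ≤
      Real.log Y * ∑ p ∈ (⌊Y⌋₊).primesLE \ (⌊Z⌋₊).primesLE, 1 / (p:ℝ) := by
  obtain ⟨C, hC, h⟩ := aux_lower
  refine ⟨C + Real.log 2 + Real.log 4, by positivity, ?_⟩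
  intro Y Z hZ hZY
  have hfZ : 1 ≤ ⌊Z⌋₊ := Nat.le_floor (by norm_num; linarith)
  have hfY : 1 ≤ ⌊Y⌋₊ := Nat.le_floor (by norm_num; linarith)
  have hl := h _ hfY
  have hu := aux_upper _ hfZ
  have hsub : (⌊Z⌋₊).primesLE ⊆ (⌊Y⌋₊).primesLE := by
    intro p hp
    rw [Nat.mem_primesLE] at *
    exact ⟨hp.1.trans (Nat.floor_le_floor hZY), hp.2⟩
  have hs := Finset.sum_sdiff (f := fun p : ℕ => Real.log p / (p:ℝ)) hsub
  have hY1 : Real.log Y - Real.log 2 ≤ Real.log ⌊Y⌋₊ := by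
    rw [← Real.log_div (by linarith) (by norm_num)]
    apply Real.log_le_log (by linarith)
    have := Nat.lt_floor_add_one Y
    have : (1:ℝ) ≤ ⌊Y⌋₊ := by exact_mod_cast hfY
    linarith
  have hZ1 : Real.log ⌊Z⌋₊ ≤ Real.log Z :=
    Real.log_le_log (by exact_mod_cast hfZ) (Nat.floor_le (by linarith))
  have hf : ∑ p ∈ (⌊Y⌋₊).primesLE \ (⌊Z⌋₊).primesLE, Real.log p / (p:ℝ) ≤
      Real.log Y * ∑ p ∈ (⌊Y⌋₊).primesLE \ (⌊Z⌋₊).primesLE, 1 / (p:ℝ) := by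
    rw [Finset.mul_sum]
    apply Finset.sum_le_sum
    intro p hp
    have hp' := (Finset.mem_sdiff.1 hp).1
    rw [Nat.mem_primesLE] at hp'
    have h1 : (p:ℝ) ≤ Y := (Nat.le_floor_iff (by linarith)).1 hp'.1
    have h0 : (0:ℝ) < p := by exact_mod_cast hp'.2.pos
    rw [mul_one_div]
    gcongr
  linarith


lemma aux_count_s14 (q N d : ℕ) (hq : q.Prime) (hd : d ≠ 0) (I : Finset ℕ) (Y Z : ℝ) (hZ : 1 < Z)
    (hY : Y < q)
    (hI : ∀ p ∈ I, p.Prime ∧ Z < p ∧ (p:ℝ) ≤ Y)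
    (hYN : Y ^ N = q) (hZN : (q:ℝ) ≤ Y * Z ^ N) (hZ2 : (q:ℝ) ≤ Z ^ (2 * N))
    (H : ∀ n : ℕ, 1 ≤ n → (n:ℝ) ≤ Y → (n : ZMod q) ^ d = 1) :
    (q:ℝ) / 2 * (∑ p ∈ I, 1 / (p:ℝ)) ^ N ≤ (2 * N) ^ N * d := by
  classical
  have : Fact q.Prime := ⟨hq⟩
  have hq0 : 0 < q := hq.pos
  let T : Finset (Σ _ : Fin N → ℕ, ℕ) :=
    (Fintype.piFinset (fun _ : Fin N => I)).sigma (fun f => Finset.Icc 1 (q / ∏ i, f i))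
  let g : (Σ _ : Fin N → ℕ, ℕ) → ℕ := fun x => x.2 * ∏ i, x.1 i
  have hprodpos : ∀ f ∈ Fintype.piFinset (fun _ : Fin N => I), 0 < ∏ i, f i := by
    intro f hf
    rw [Fintype.mem_piFinset] at hf
    exact Finset.prod_pos fun i _ => (hI _ (hf i)).1.pos
  have hprodle : ∀ f ∈ Fintype.piFinset (fun _ : Fin N => I), ∏ i, f i ≤ q := by
    intro f hf
    rw [Fintype.mem_piFinset] at hf
    have : ((∏ i, f i : ℕ) : ℝ) ≤ q := by
      rw [← hYN]
      push_cast
      calc ∏ i, (f i : ℝ) ≤ ∏ i : Fin N, Y :=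
            Finset.prod_le_prod (fun i _ => by positivity) (fun i _ => (hI _ (hf i)).2.2)
        _ = Y ^ N := by simp
    exact_mod_cast this
  have hprodge : ∀ f ∈ Fintype.piFinset (fun _ : Fin N => I), Z ^ N ≤ ((∏ i, f i : ℕ) : ℝ) := by
    intro f hf
    rw [Fintype.mem_piFinset] at hf
    push_cast
    calc Z ^ N = ∏ i : Fin N, Z := by simp
      _ ≤ _ := Finset.prod_le_prod (fun i _ => by linarith) (fun i _ => (hI _ (hf i)).2.1.le)
  -- lower bound for the number of tuples
  have hlow : (q:ℝ) / 2 * (∑ p ∈ I, 1 / (p:ℝ)) ^ N ≤ (#T : ℝ) := by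
    have e1 : (∑ p ∈ I, 1 / (p:ℝ)) ^ N =
        ∑ f ∈ Fintype.piFinset (fun _ : Fin N => I), ∏ i, 1 / (f i : ℝ) := by
      rw [← Finset.prod_univ_sum (fun _ : Fin N => I) (fun _ (p : ℕ) => 1 / (p:ℝ))]
      simp
    rw [e1, Finset.card_sigma, Finset.mul_sum, Nat.cast_sum]
    apply Finset.sum_le_sum
    intro f hf
    have h0 := hprodpos f hf
    have h1 := hprodle f hf
    rw [Nat.card_Icc, Nat.add_sub_cancel]
    have h2 : ∏ i, 1 / (f i : ℝ) = 1 / ((∏ i, f i : ℕ) : ℝ) := by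
      push_cast; simp
    rw [h2]
    generalize (∏ i, f i) = P at h0 h1
    have h3 : (q:ℝ) / P < (q / P : ℕ) + 1 := by
      have := Nat.lt_floor_add_one ((q:ℝ) / P)
      rwa [Nat.floor_div_natCast, Nat.floor_natCast] at this
    have h4 : (1:ℝ) ≤ (q / P : ℕ) := by
      exact_mod_cast (Nat.one_le_div_iff h0).2 h1
    have h5 : (q:ℝ) / 2 * (1 / P) = (q / P) / 2 := by ring
    rw [h5]
    linarith
  have hT : ∀ x ∈ T, 1 ≤ x.2 ∧ 1 ≤ g x ∧ g x ≤ q ∧ ((g x : ℕ) : ZMod q) ^ d = 1 := by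
    rintro ⟨f, m⟩ hx
    rw [Finset.mem_sigma, Finset.mem_Icc] at hx
    obtain ⟨hf, hm1, hm2⟩ := hx
    simp only at hf hm1 hm2
    have h0 := hprodpos f hf
    have hle : m * ∏ i, f i ≤ q := (Nat.le_div_iff_mul_le h0).1 hm2
    refine ⟨hm1, Nat.mul_pos hm1 h0, hle, ?_⟩
    have hmY : (m:ℝ) ≤ Y := by
      have h1 : (m:ℝ) * ((∏ i, f i : ℕ) : ℝ) ≤ q := by exact_mod_cast hle
      have h2 := hprodge f hf
      have h3 : (m:ℝ) * Z ^ N ≤ Y * Z ^ N :=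
        (mul_le_mul_of_nonneg_left h2 (by positivity)).trans (h1.trans hZN)
      exact le_of_mul_le_mul_right h3 (by positivity)
    rw [Fintype.mem_piFinset] at hf
    simp only [g]
    push_cast
    rw [mul_pow, H m hm1 hmY, one_mul, ← Finset.prod_pow]
    exact Finset.prod_eq_one fun i _ => H _ (hI _ (hf i)).1.one_le (hI _ (hf i)).2.2
  -- fibres
  have hfib : #T ≤ (2 * N) ^ N * #(T.image g) := by
    apply Finset.card_le_mul_card_image
    intro n hn
    obtain ⟨x0, hx0, rfl⟩ := Finset.mem_image.1 hn
    obtain ⟨-, hn1, hnq, -⟩ := hT x0 hx0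
    generalize g x0 = n at hn1 hnq hn
    let B := n.primeFactors.filter (fun p : ℕ => Z < (p:ℝ))
    have hB : #B ≤ 2 * N := by
      have h1 : Z ^ #B ≤ ((∏ p ∈ B, p : ℕ) : ℝ) := by
        push_cast
        rw [← Finset.prod_const]
        exact Finset.prod_le_prod (fun i _ => by linarith)
          (fun p hp => (Finset.mem_filter.1 hp).2.le)
      have h2 : ∏ p ∈ B, p ≤ n := by
        apply Nat.le_of_dvd hn1
        exact (Finset.prod_dvd_prod_of_subset _ _ _ (Finset.filter_subset _ _)).trans
          (Nat.prod_primeFactors_dvd n)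
      have h3 : ((∏ p ∈ B, p : ℕ) : ℝ) ≤ q := by exact_mod_cast h2.trans hnq
      exact (pow_le_pow_iff_right₀ hZ).1 (h1.trans (h3.trans hZ2))
    calc #{x ∈ T | g x = n} ≤ #(Fintype.piFinset (fun _ : Fin N => B)) := by
          apply Finset.card_le_card_of_injOn (fun x => x.1)
          · rintro ⟨f, m⟩ hx
            simp only [Finset.coe_filter, Set.mem_ofPred_eq] at hx
            obtain ⟨hxT, hg⟩ := hx
            have hf := (Finset.mem_sigma.1 hxT).1
            simp only at hf
            rw [Fintype.mem_piFinset] at hf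
            simp only [Finset.mem_coe, Fintype.mem_piFinset]
            intro i
            refine Finset.mem_filter.2 ⟨?_, (hI _ (hf i)).2.1⟩
            refine Nat.mem_primeFactors.2 ⟨(hI _ (hf i)).1, ?_, by omega⟩
            rw [← hg]
            exact (Finset.dvd_prod_of_mem f (Finset.mem_univ i)).mul_left _
          · rintro ⟨f, m⟩ hx ⟨f', m'⟩ hx' heq
            simp only [Finset.coe_filter, Set.mem_ofPred_eq] at hx hx' heq
            subst heq
            have h0 := hprodpos f (Finset.mem_sigma.1 hx.1).1
            have h : m * ∏ i, f i = m' * ∏ i, f i := hx.2.trans hx'.2.symm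
            rw [Nat.eq_of_mul_eq_mul_right h0 h]
      _ = #B ^ N := by simp
      _ ≤ (2 * N) ^ N := Nat.pow_le_pow_left hB N
  have himg : #(T.image g) ≤ d := by
    calc #(T.image g) ≤ #((Polynomial.nthRoots d (1 : ZMod q)).toFinset) := by
          have hprop : ∀ n ∈ T.image g, n < q ∧ (n : ZMod q) ^ d = 1 := by
            intro n hn
            obtain ⟨x, hx, rfl⟩ := Finset.mem_image.1 hn
            obtain ⟨-, h1, h2, h3⟩ := hT x hx
            refine ⟨lt_of_le_of_ne h2 ?_, h3⟩
            intro h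
            rw [h] at h3
            simp [hd] at h3
          apply Finset.card_le_card_of_injOn (fun n : ℕ => (n : ZMod q))
          · intro n hn
            simp only [Finset.mem_coe, Multiset.mem_toFinset]
            rw [Polynomial.mem_nthRoots (Nat.pos_of_ne_zero hd)]
            exact (hprop n hn).2
          · intro a ha b hb hab
            simp only at hab
            rw [ZMod.natCast_eq_natCast_iff'] at hab
            rwa [Nat.mod_eq_of_lt (hprop a ha).1, Nat.mod_eq_of_lt (hprop b hb).1] at hab
      _ ≤ Multiset.card (Polynomial.nthRoots d (1 : ZMod q)) := Multiset.toFinset_card_le _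
      _ ≤ d := Polynomial.card_nthRoots d 1
  have : #T ≤ (2 * N) ^ N * d := hfib.trans (Nat.mul_le_mul_left _ himg)
  calc _ ≤ (#T : ℝ) := hlow
    _ ≤ (((2 * N) ^ N * d : ℕ) : ℝ) := by exact_mod_cast this
    _ = _ := by push_cast; ring

theorem friable_power_congruence_rigidity :
    ∀ δ : ℝ, 0 < δ → δ < 1 → ∃ c : ℝ, 0 < c ∧ c < 1 ∧ ∃ q₀ : ℕ,
      ∀ q : ℕ, q.Prime → q₀ ≤ q →
      ∀ d₁ d₂ : ℕ, d₁ ≤ d₂ → (d₂ : ℝ) ≤ c * q →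
      (∀ n : ℕ, 1 ≤ n → (n : ℝ) ≤ (q : ℝ) ^ δ →
        (n : ZMod q) ^ d₂ = (n : ZMod q) ^ d₁) →
      d₁ = d₂ := by
  intro δ hδ0 hδ1
  obtain ⟨C, hC, hint⟩ := aux_interval
  obtain ⟨N, hN2, hNδ⟩ : ∃ N : ℕ, 2 ≤ N ∧ 1 / (N:ℝ) ≤ δ := by
    refine ⟨⌈1 / δ⌉₊ + 2, by omega, ?_⟩
    rw [div_le_iff₀ (by positivity)]
    have h := Nat.le_ceil (1 / δ)
    rw [div_le_iff₀ hδ0] at h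
    push_cast
    nlinarith
  have hNr : (2:ℝ) ≤ N := by exact_mod_cast hN2
  have hN0 : (0:ℝ) < N := by linarith
  set a : ℝ := (1 / (2 * (N:ℝ))) ^ N with ha
  have ha0 : 0 < a := by positivity
  have ha1 : a ≤ 1 := by
    apply pow_le_one₀ (by positivity)
    rw [div_le_one (by positivity)]; linarith
  have haN : a * (2 * N) ^ N = 1 := by
    rw [ha, ← mul_pow, one_div, inv_mul_cancel₀ (by positivity), one_pow]
  refine ⟨a * a / 4, by positivity, by nlinarith,
    ⌈Real.exp (2 * N * Real.log 2 + C * (2 * N ^ 2) + 1)⌉₊, ?_⟩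
  intro q hq hq0 d₁ d₂ hle hd2 H
  by_contra hne
  have hd : d₂ - d₁ ≠ 0 := by omega
  have hqexp : Real.exp (2 * N * Real.log 2 + C * (2 * N ^ 2) + 1) ≤ q := Nat.ceil_le.1 hq0
  have hqpos : (0:ℝ) < q := by exact_mod_cast hq.pos
  have hq1 : (1:ℝ) < q := by exact_mod_cast hq.one_lt
  have hL : 2 * N * Real.log 2 + C * (2 * N ^ 2) + 1 ≤ Real.log q :=
    (Real.le_log_iff_exp_le hqpos).2 hqexp
  have hlog2 : 0 < Real.log 2 := Real.log_pos (by norm_num)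
  set L := Real.log q with hLdef
  set z : ℝ := (1 - 1 / N) / N with hz
  have hinv : 1 / (N:ℝ) ≤ 1 / 2 := one_div_le_one_div_of_le (by norm_num) hNr
  have hz2 : 1 / (2 * (N:ℝ)) ≤ z := by
    rw [hz, le_div_iff₀ hN0]
    have : 1 / (2 * (N:ℝ)) * N = 1 / 2 := by field_simp
    linarith
  have hzy : z ≤ 1 / N := by
    rw [hz]
    have : 0 ≤ 1 / (N:ℝ) := by positivity
    gcongr
    linarith
  have hNz : z * N = 1 - 1 / N := by rw [hz]; field_simp
  set Y : ℝ := (q:ℝ) ^ (1 / (N:ℝ)) with hYdef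
  set Z : ℝ := (q:ℝ) ^ z with hZdef
  have hlogY : Real.log Y = 1 / N * L := Real.log_rpow hqpos _
  have hlogZ : Real.log Z = z * L := Real.log_rpow hqpos _
  have hCN : 0 ≤ C * (2 * N ^ 2) := by positivity
  have hZ2 : 2 ≤ Z := by
    rw [← Real.log_le_log_iff (by norm_num) (by positivity), hlogZ]
    have h1 : 1 / (2 * (N:ℝ)) * (2 * N * Real.log 2) ≤ z * L :=
      mul_le_mul hz2 (by linarith) (by positivity) (le_trans (by positivity) hz2)
    have h2 : 1 / (2 * (N:ℝ)) * (2 * N * Real.log 2) = Real.log 2 := by field_simp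
    linarith
  have hZY : Z ≤ Y := Real.rpow_le_rpow_of_exponent_le hq1.le hzy
  have hYδ : Y ≤ (q:ℝ) ^ δ := Real.rpow_le_rpow_of_exponent_le hq1.le hNδ
  have hδq : (q:ℝ) ^ δ < q := by
    conv_rhs => rw [← Real.rpow_one (q:ℝ)]
    exact Real.rpow_lt_rpow_of_exponent_lt hq1 hδ1
  have hYN : Y ^ N = q := by
    rw [hYdef, ← Real.rpow_natCast, ← Real.rpow_mul hqpos.le, one_div_mul_cancel hN0.ne',
      Real.rpow_one]
  have hZNe : Z ^ N = (q:ℝ) ^ (1 - 1 / (N:ℝ)) := by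
    rw [hZdef, ← Real.rpow_natCast, ← Real.rpow_mul hqpos.le, hNz]
  have hZN : (q:ℝ) ≤ Y * Z ^ N := by
    rw [hZNe, hYdef, ← Real.rpow_add hqpos]
    simp
  have hZ2N : (q:ℝ) ≤ Z ^ (2 * N) := by
    rw [hZdef, ← Real.rpow_natCast, ← Real.rpow_mul hqpos.le]
    conv_lhs => rw [← Real.rpow_one (q:ℝ)]
    apply Real.rpow_le_rpow_of_exponent_le hq1.le
    push_cast
    linarith
  have := Fact.mk hq
  have H' : ∀ n : ℕ, 1 ≤ n → (n:ℝ) ≤ Y → (n : ZMod q) ^ (d₂ - d₁) = 1 := by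
    intro n hn hnY
    have hnq : n < q := by exact_mod_cast (hnY.trans hYδ).trans_lt hδq
    have hn0 : (n : ZMod q) ≠ 0 := by
      rw [Ne, ZMod.natCast_eq_zero_iff]
      exact Nat.not_dvd_of_pos_of_lt hn hnq
    have h := H n hn (hnY.trans hYδ)
    have h2 : (n : ZMod q) ^ d₁ * (n : ZMod q) ^ (d₂ - d₁) = (n : ZMod q) ^ d₁ * 1 := by
      rw [← pow_add, Nat.add_sub_cancel' hle, h, mul_one]
    exact mul_left_cancel₀ (pow_ne_zero _ hn0) h2
  have hcount := aux_count_s14 q N (d₂ - d₁) hq hd ((⌊Y⌋₊).primesLE \ (⌊Z⌋₊).primesLE) Y Z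
    (by linarith) (hYδ.trans_lt hδq) (by
      intro p hp
      rw [Finset.mem_sdiff, Nat.mem_primesLE, Nat.mem_primesLE] at hp
      obtain ⟨⟨h1, h2⟩, h3⟩ := hp
      refine ⟨h2, ?_, (Nat.le_floor_iff (by linarith)).1 h1⟩
      by_contra hcon
      exact h3 ⟨Nat.le_floor (not_lt.1 hcon), h2⟩) hYN hZN hZ2N H'
  have hi := hint Y Z hZ2 hZY
  set S := ∑ p ∈ (⌊Y⌋₊).primesLE \ (⌊Z⌋₊).primesLE, 1 / (p:ℝ) with hS
  have hLpos : 0 < L := Real.log_pos hq1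
  have hSlow : 1 / (2 * (N:ℝ)) ≤ S := by
    rw [hlogY, hlogZ, hz] at hi
    have h1 : 1 / (N:ℝ) * L - (1 - 1 / N) / N * L = L / N ^ 2 := by field_simp; ring
    have h2 : C ≤ L / (2 * N ^ 2) := by
      rw [le_div_iff₀ (by positivity)]
      have : 0 ≤ 2 * N * Real.log 2 := by positivity
      linarith
    have h3 : L / (N:ℝ) ^ 2 - L / (2 * N ^ 2) = 1 / N * L * (1 / (2 * N)) := by field_simp; ring
    have h4 : 1 / N * L * (1 / (2 * N)) ≤ 1 / N * L * S := by linarith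
    exact le_of_mul_le_mul_left h4 (by positivity)
  have hSN : a ≤ S ^ N := by
    rw [ha]
    exact pow_le_pow_left₀ (by positivity) hSlow N
  have hdc : ((d₂ - d₁ : ℕ) : ℝ) ≤ a * a / 4 * q :=
    le_trans (by exact_mod_cast Nat.sub_le _ _) hd2
  have hfin : (q:ℝ) / 2 * a ≤ (2 * N) ^ N * (a * a / 4 * q) :=
    calc (q:ℝ) / 2 * a ≤ q / 2 * S ^ N := by gcongr
      _ ≤ _ := hcount
      _ ≤ _ := by gcongr
  have he : (2 * (N:ℝ)) ^ N * (a * a / 4 * q) = (a * (2 * N) ^ N) * (a * q / 4) := by ring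
  rw [he, haN] at hfin
  have : 0 < a * q := by positivity
  linarith
end

section
/- There exists an absolute constant C > 0 such that the following holds. Let q be a prime, let χ be a primitive Dirichlet character modulo q of order d, let I ⊆ [0,1] be an open interval, and let K ≥ 1. Then | #{1 ≤ n < q : θ(n) ∈ I} − q·|I| | ≤ C·q·( 1/K + log(1 + ⌊K/d⌋)/d ), where for 1 ≤ n < q, θ(n) denotes the unique element of [0,1) with χ(n) = e(θ(n)), and |I| is the length of I. -/
open Finset
open scoped Classical

/-- reindex a count over `1 ≤ n < q` by units -/
lemma aux_count_units (q : ℕ) [hq : Fact q.Prime] (P : ℕ → Prop) [DecidablePred P] :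
    ((Finset.Ico 1 q).filter P).card =
      ((Finset.univ : Finset (ZMod q)ˣ).filter (fun u : (ZMod q)ˣ => P (u : ZMod q).val)).card := by
  symm
  refine Finset.card_bij (fun u _ => (u : ZMod q).val) ?_ ?_ ?_
  · intro u hu
    simp only [Finset.mem_filter, Finset.mem_univ, true_and] at hu
    simp only [Finset.mem_filter, Finset.mem_Ico]
    refine ⟨⟨?_, ZMod.val_lt _⟩, hu⟩
    rw [Nat.one_le_iff_ne_zero, Ne, ZMod.val_eq_zero]
    exact u.ne_zero
  · intro u _ v _ h
    exact Units.ext (ZMod.val_injective q h)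
  · intro n hn
    simp only [Finset.mem_filter, Finset.mem_Ico] at hn
    have hcop : n.Coprime q := by
      rw [Nat.coprime_comm, hq.out.coprime_iff_not_dvd]
      exact Nat.not_dvd_of_pos_of_lt hn.1.1 hn.1.2
    have hv : ((ZMod.unitOfCoprime n hcop : (ZMod q)ˣ) : ZMod q).val = n := by
      rw [ZMod.coe_unitOfCoprime, ZMod.val_natCast_of_lt hn.1.2]
    refine ⟨ZMod.unitOfCoprime n hcop, ?_, hv⟩
    simp only [Finset.mem_filter, Finset.mem_univ, true_and]
    rw [hv]; exact hn.2

/-- every `d`-th root of unity is a value of a character of order `d` -/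
lemma aux_range (q : ℕ) [hq : Fact q.Prime] (χ : DirichletCharacter ℂ q) (w : ℂ)
    (hw : w ^ (orderOf χ) = 1) : ∃ u : (ZMod q)ˣ, χ u = w := by
  obtain ⟨g, hg⟩ := IsCyclic.exists_generator (α := (ZMod q)ˣ)
  have hd : 0 < orderOf χ := orderOf_pos χ
  have hprim : IsPrimitiveRoot (χ g) (orderOf χ) := by
    have : orderOf (χ g) = orderOf χ := by
      apply orderOf_eq_orderOf_iff.2
      intro n
      constructor
      · intro h
        apply MulChar.ext
        intro u
        obtain ⟨i, hi⟩ := (mem_powers_iff_mem_zpowers.2 (hg u))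
        simp only at hi
        rw [← hi, MulChar.pow_apply_coe, MulChar.one_apply_coe, Units.val_pow_eq_pow_val, map_pow,
          ← pow_mul, mul_comm, pow_mul, h, one_pow]
      · intro h
        rw [← MulChar.pow_apply_coe, h, MulChar.one_apply_coe]
    rw [← this]
    exact IsPrimitiveRoot.orderOf _
  have : NeZero (orderOf χ) := ⟨hd.ne'⟩
  obtain ⟨i, _, hi⟩ := hprim.eq_pow_of_pow_eq_one hw
  exact ⟨g ^ i, by rw [Units.val_pow_eq_pow_val, map_pow, hi]⟩

lemma aux_fiber (q : ℕ) [hq : Fact q.Prime] (χ : DirichletCharacter ℂ q) (w : ℂ)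
    (hw : w ^ (orderOf χ) = 1) :
    ((Finset.univ : Finset (ZMod q)ˣ).filter (fun u : (ZMod q)ˣ => χ u = w)).card =
    ((Finset.univ : Finset (ZMod q)ˣ).filter (fun u : (ZMod q)ˣ => χ u = 1)).card := by
  obtain ⟨v, rfl⟩ := aux_range q χ w hw
  have hv : χ v ≠ 0 := (v.isUnit.map χ).ne_zero
  refine Finset.card_bij (fun u _ => u * v⁻¹) ?_ ?_ ?_
  · intro u hu
    simp only [Finset.mem_filter, Finset.mem_univ, true_and] at hu ⊢
    have : χ ((u * v⁻¹ : (ZMod q)ˣ) : ZMod q) * χ v = χ v := by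
      rw [← map_mul, ← Units.val_mul, inv_mul_cancel_right, hu]
    exact mul_right_cancel₀ hv (by rw [this, one_mul])
  · intro u _ u' _ h
    exact mul_right_cancel h
  · intro u hu
    simp only [Finset.mem_filter, Finset.mem_univ, true_and] at hu
    refine ⟨u * v, ?_, by simp⟩
    simp [hu]

lemma aux_exp_inj {x y : ℝ} (hx : x ∈ Set.Ico (0 : ℝ) 1) (hy : y ∈ Set.Ico (0 : ℝ) 1)
    (h : Complex.exp (2 * Real.pi * Complex.I * (x : ℂ)) =
      Complex.exp (2 * Real.pi * Complex.I * (y : ℂ))) : x = y := by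
  obtain ⟨n, hn⟩ := Complex.exp_eq_exp_iff_exists_int.1 h
  have h2 : (2 * Real.pi * Complex.I : ℂ) ≠ 0 := Complex.two_pi_I_ne_zero
  have h3 : (x : ℂ) = y + n := mul_left_cancel₀ h2 (by rw [hn]; ring)
  have h4 : x = y + n := by exact_mod_cast h3
  have h5 : (n : ℝ) < 1 := by linarith [hx.2, hy.1]
  have h6 : (-1 : ℝ) < n := by linarith [hx.1, hy.2]
  have h7 : n < 1 := by exact_mod_cast h5
  have h8 : -1 < n := by exact_mod_cast h6
  have h9 : n = 0 := by omega
  rw [h4, h9]; simp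

lemma aux_exp_pow (d : ℕ) (hd : 0 < d) (j : ℤ) :
    Complex.exp (2 * Real.pi * Complex.I * ((j / d : ℝ) : ℂ)) ^ d = 1 := by
  rw [← Complex.exp_nat_mul, Complex.exp_eq_one_iff]
  refine ⟨j, ?_⟩
  have : (d : ℂ) ≠ 0 := by exact_mod_cast hd.ne'
  push_cast
  field_simp

theorem erdos_turan_equidistribution_of_character_args :
    ∃ C : ℝ, 0 < C ∧
    ∀ q : ℕ, q.Prime →
    ∀ d : ℕ, ∀ χ : DirichletCharacter ℂ q, χ.IsPrimitive → orderOf χ = d →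
    ∀ θ : ℕ → ℝ,
      (∀ n : ℕ, 1 ≤ n → n < q → θ n ∈ Set.Ico (0 : ℝ) 1 ∧
        χ (n : ZMod q) = Complex.exp (2 * Real.pi * Complex.I * (θ n : ℂ))) →
    ∀ a b : ℝ, 0 ≤ a → a ≤ b → b ≤ 1 →
    ∀ K : ℝ, 1 ≤ K →
      |(((Finset.Ico 1 q).filter (fun n => θ n ∈ Set.Ioo a b)).card : ℝ) - q * (b - a)| ≤
        C * q * (1 / K + Real.log (1 + (⌊K / (d : ℝ)⌋₊ : ℝ)) / (d : ℝ)) := by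
  refine ⟨4, by norm_num, ?_⟩
  intro q hq d χ _ hd θ hθ a b ha hab hb K hK
  have : Fact q.Prime := ⟨hq⟩
  have hd0 : 0 < d := hd ▸ orderOf_pos χ
  have hdR : (0 : ℝ) < d := by exact_mod_cast hd0
  set t : (ZMod q)ˣ → ℝ := fun u => θ (u : ZMod q).val with ht
  have htu : ∀ u, t u ∈ Set.Ico (0 : ℝ) 1 ∧
      χ u = Complex.exp (2 * Real.pi * Complex.I * (t u : ℂ)) := by
    intro u
    have := hθ (u : ZMod q).val
      (by rw [Nat.one_le_iff_ne_zero, Ne, ZMod.val_eq_zero]; exact u.ne_zero) (ZMod.val_lt _)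
    rwa [ZMod.natCast_zmod_val] at this
  set c := ((Finset.univ : Finset (ZMod q)ˣ).filter (fun u : (ZMod q)ˣ => χ u = 1)).card with hc
  -- angles are multiples of 1/d
  have hint : ∀ u, ∃ j : ℤ, t u * d = j := by
    intro u
    have h1 : χ u ^ d = 1 := by
      rw [← MulChar.pow_apply_coe, ← hd, pow_orderOf_eq_one, MulChar.one_apply_coe]
    rw [(htu u).2, ← Complex.exp_nat_mul, Complex.exp_eq_one_iff] at h1
    obtain ⟨j, hj⟩ := h1
    refine ⟨j, ?_⟩
    have h2 : ((t u * d : ℝ) : ℂ) = (j : ℂ) :=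
      mul_left_cancel₀ Complex.two_pi_I_ne_zero (by push_cast; linear_combination hj)
    exact_mod_cast h2
  choose J hJ using hint
  have hfib : ∀ j : ℤ, 0 ≤ j → j < d →
      ((Finset.univ : Finset (ZMod q)ˣ).filter (fun u : (ZMod q)ˣ => J u = j)).card = c := by
    intro j h0 h1
    have hp := aux_exp_pow d hd0 j
    rw [hc, ← aux_fiber q χ (Complex.exp (2 * Real.pi * Complex.I * ((j / d : ℝ) : ℂ)))
      (by rw [hd]; exact hp)]
    congr 1
    apply Finset.filter_congr
    intro u _
    have h0' : (0 : ℝ) ≤ j := by exact_mod_cast h0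
    have h1' : (j : ℝ) < d := by exact_mod_cast h1
    have hmem : (j / d : ℝ) ∈ Set.Ico (0 : ℝ) 1 :=
      ⟨by positivity, (div_lt_one hdR).2 h1'⟩
    rw [(htu u).2]
    constructor
    · intro h
      rw [← h, ← hJ u, mul_div_cancel_right₀ _ hdR.ne']
    · intro h
      have h3 := aux_exp_inj (htu u).1 hmem h
      have h4 := hJ u
      rw [h3, div_mul_cancel₀ _ hdR.ne'] at h4
      exact_mod_cast h4.symm
  have hcount : ∀ S : Finset ℤ, (∀ j ∈ S, 0 ≤ j ∧ j < d) →
      ((Finset.univ : Finset (ZMod q)ˣ).filter (fun u : (ZMod q)ˣ => J u ∈ S)).card = S.card * c := by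
    intro S hS
    rw [Finset.card_eq_sum_card_fiberwise (f := J) (t := S)
      (by intro u hu; simpa using hu)]
    rw [Finset.sum_congr rfl (g := fun _ => c)]
    · simp
    · intro j hj
      rw [← hfib j (hS j hj).1 (hS j hj).2, Finset.filter_filter]
      congr 1
      apply Finset.filter_congr
      intro u _
      constructor
      · exact fun h => h.2
      · exact fun h => ⟨h ▸ hj, h⟩
  have hJr : ∀ u, 0 ≤ J u ∧ J u < d := by
    intro u
    have h := htu u
    constructor
    · have : (0 : ℝ) ≤ J u := by rw [← hJ u]; exact mul_nonneg h.1.1 hdR.le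
      exact_mod_cast this
    · have : (J u : ℝ) < d := by rw [← hJ u]; nlinarith [h.1.2]
      exact_mod_cast this
  have htot : d * c = q - 1 := by
    have h := hcount (Finset.Ico 0 (d : ℤ)) (by intro j hj; simpa using hj)
    rw [Finset.filter_true_of_mem (by intro u _; simpa using hJr u), Finset.card_univ,
      ZMod.card_units_eq_totient, Nat.totient_prime hq] at h
    simpa using h.symm
  have hmain : ((Finset.Ico 1 q).filter (fun n => θ n ∈ Set.Ioo a b)).card =
      (Finset.Ioo ⌊a * d⌋ ⌈b * d⌉).card * c := by
    rw [aux_count_units q (fun n => θ n ∈ Set.Ioo a b), ← hcount]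
    · congr 1
      apply Finset.filter_congr
      intro u _
      change t u ∈ Set.Ioo a b ↔ _
      rw [Set.mem_Ioo, Finset.mem_Ioo, Int.floor_lt, Int.lt_ceil, ← hJ u,
        mul_lt_mul_iff_left₀ hdR, mul_lt_mul_iff_left₀ hdR]
    · intro j hj
      rw [Finset.mem_Ioo, Int.floor_lt, Int.lt_ceil] at hj
      constructor
      · have : (0 : ℝ) ≤ j := by nlinarith [hj.1]
        exact_mod_cast this
      · have : (j : ℝ) < d := by nlinarith [hj.2]
        exact_mod_cast this
  rw [hmain]
  set m := (Finset.Ioo ⌊a * d⌋ ⌈b * d⌉).card with hm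
  have hmb : |(m : ℝ) - d * (b - a)| ≤ 1 := by
    have h1 := Int.floor_le (a * d)
    have h2 := Int.lt_floor_add_one (a * d)
    have h3 := Int.le_ceil (b * d)
    have h4 := Int.ceil_lt_add_one (b * d)
    have h5 : a * d ≤ b * d := by nlinarith
    rw [Int.card_Ioo] at hm
    have h6 : (m : ℤ) = max (⌈b * d⌉ - ⌊a * d⌋ - 1) 0 := by rw [hm, Int.ofNat_toNat]
    have h7 : (m : ℝ) = max ((⌈b * d⌉ : ℝ) - ⌊a * d⌋ - 1) 0 := by exact_mod_cast h6
    rw [abs_le, h7]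
    rcases le_total ((⌈b * d⌉ : ℝ) - ⌊a * d⌋ - 1) 0 with h | h
    · rw [max_eq_right h]; constructor <;> nlinarith
    · rw [max_eq_left h]; constructor <;> nlinarith
  have hq1 : 1 < q := hq.one_lt
  have htR : (d : ℝ) * c = q - 1 := by
    have : d * c + 1 = q := by omega
    have h : (d : ℝ) * c + 1 = q := by exact_mod_cast this
    linarith
  have hc0 : (0 : ℝ) ≤ c := by positivity
  have herr : |((m * c : ℕ) : ℝ) - q * (b - a)| ≤ c + 1 := by
    have : ((m * c : ℕ) : ℝ) - q * (b - a) = (m - d * (b - a)) * c - (b - a) := by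
      push_cast; linear_combination (b - a) * htR
    rw [this]
    obtain ⟨h1, h2⟩ := abs_le.1 hmb
    rw [abs_le]
    constructor <;> nlinarith
  have hc1 : (1 : ℝ) ≤ c := by
    have : 0 < c := by
      rcases Nat.eq_zero_or_pos c with h | h
      · rw [h] at htot; omega
      · exact h
    exact_mod_cast this
  have hcq : (c : ℝ) ≤ q / d := by
    rw [le_div_iff₀ hdR]; linarith
  have hkey : 1 / (2 * d : ℝ) ≤ 1 / K + Real.log (1 + (⌊K / (d : ℝ)⌋₊ : ℝ)) / (d : ℝ) := by
    have hK0 : 0 < K := by linarith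
    have hlog0 : 0 ≤ Real.log (1 + (⌊K / (d : ℝ)⌋₊ : ℝ)) :=
      Real.log_nonneg (by simp)
    rcases le_total K d with h | h
    · have h1 : 1 / (2 * d : ℝ) ≤ 1 / K := one_div_le_one_div_of_le hK0 (by linarith)
      have h2 : 0 ≤ Real.log (1 + (⌊K / (d : ℝ)⌋₊ : ℝ)) / (d : ℝ) := by positivity
      linarith
    · have hf : 1 ≤ ⌊K / (d : ℝ)⌋₊ := Nat.le_floor (by simpa using (one_le_div hdR).2 h)
      have hf' : (1 : ℝ) ≤ ⌊K / (d : ℝ)⌋₊ := by exact_mod_cast hf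
      have hl : Real.log 2 ≤ Real.log (1 + (⌊K / (d : ℝ)⌋₊ : ℝ)) :=
        Real.log_le_log (by norm_num) (by linarith)
      have hl2 := Real.log_two_gt_d9
      have h1 : (1 / 2) / (d : ℝ) ≤ Real.log (1 + (⌊K / (d : ℝ)⌋₊ : ℝ)) / (d : ℝ) :=
        div_le_div_of_nonneg_right (by linarith) hdR.le
      have h2 : 0 ≤ 1 / K := by positivity
      have h3 : 1 / (2 * d : ℝ) = (1 / 2) / d := by field_simp
      linarith
  have hqR : (0 : ℝ) ≤ 4 * q := by positivity
  calc _ ≤ (c : ℝ) + 1 := herr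
    _ ≤ 2 * (q / d) := by linarith
    _ = 4 * q * (1 / (2 * d : ℝ)) := by field_simp; norm_num
    _ ≤ _ := mul_le_mul_of_nonneg_left hkey hqR
end

section
/- There exists an absolute constant C > 0 such that for every integer d ≥ 2, every ε ∈ (0,1) with P⁻(d) > 1/ε, and every integer 1 ≤ m ≤ d−1, one has #{1 ≤ ℓ ≤ d : ‖ℓm/d‖ ≤ ε^{1/2}} ≤ C·ε^{1/2}·d. -/
open Finset
open scoped Classical

/-- Distance from a real number to the nearest integer. -/
noncomputable def nearestIntDist (t : ℝ) : ℝ := |t - round t|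

theorem few_multiples_close_to_integers :
    ∃ C : ℝ, 0 < C ∧ ∀ d : ℕ, 2 ≤ d → ∀ ε : ℝ, 0 < ε → ε < 1 →
      (1 / ε : ℝ) < (d.minFac : ℝ) →
      ∀ m : ℕ, 1 ≤ m → m ≤ d - 1 →
      (((Finset.Icc 1 d).filter
          (fun ℓ => nearestIntDist ((ℓ * m : ℕ) / (d : ℝ)) ≤ Real.sqrt ε)).card : ℝ) ≤
        C * Real.sqrt ε * d := by
  refine ⟨3, by norm_num, ?_⟩
  intro d hd ε hε hε1 hmin m hm hmd
  have hgpos : 0 < Nat.gcd m d := Nat.gcd_pos_of_pos_left _ (by omega)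
  obtain ⟨g, n, q, hg, hcop, hmn, hdq⟩ := Nat.exists_coprime' hgpos
  have hqpos : 0 < q := by
    rcases Nat.eq_zero_or_pos q with h | h
    · subst h; omega
    · exact h
  have hq1 : q ≠ 1 := by
    rintro rfl
    have : g ≤ m := Nat.le_of_dvd (by omega) ⟨n, by rw [hmn]; ring⟩
    omega
  have hqmin : d.minFac ≤ q := Nat.minFac_le_of_dvd (by omega) ⟨g, hdq⟩
  have hqR : (0:ℝ) < q := by exact_mod_cast hqpos
  have hgR : (0:ℝ) < g := by exact_mod_cast hg
  have hqε : 1 < ε * q := by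
    have h1 : (1 / ε : ℝ) < q := hmin.trans_le (by exact_mod_cast hqmin)
    rw [div_lt_iff₀ hε] at h1
    linarith
  set s := Real.sqrt ε with hs
  have hs0 : 0 < s := Real.sqrt_pos.mpr hε
  have hss : s * s = ε := Real.mul_self_sqrt hε.le
  have hs1 : s < 1 := by nlinarith
  have hsq : 1 ≤ s * q := by nlinarith [mul_pos hs0 hqR]
  have hx : ∀ ℓ : ℕ, ((ℓ * m : ℕ) : ℝ) / (d : ℝ) = (ℓ * n : ℝ) / q := by
    intro ℓ
    rw [hmn, hdq]; push_cast
    field_simp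
  let b : ℕ → ℤ := fun ℓ => (ℓ * n : ℤ) - q * round (((ℓ * m : ℕ) : ℝ) / (d : ℝ))
  let N : ℤ := ⌊s * q⌋
  have hN0 : 0 ≤ N := Int.floor_nonneg.mpr (by positivity)
  have hcard : ((Finset.Icc 1 d).filter
      (fun ℓ => nearestIntDist ((ℓ * m : ℕ) / (d : ℝ)) ≤ s)).card ≤
      ((Finset.Icc (-N) N) ×ˢ (Finset.range g)).card := by
    apply Finset.card_le_card_of_injOn (fun ℓ => (b ℓ, (ℓ - 1) / q))
    · intro ℓ hℓ
      simp only [Finset.coe_filter, Finset.mem_Icc, Set.mem_ofPred_eq] at hℓ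
      obtain ⟨⟨h1, h2⟩, h3⟩ := hℓ
      have hb : |(b ℓ : ℝ)| ≤ s * q := by
        have : (b ℓ : ℝ) = q * (((ℓ * m : ℕ) : ℝ) / (d : ℝ)
            - round (((ℓ * m : ℕ) : ℝ) / (d : ℝ))) := by
          simp only [b]
          rw [mul_sub, hx ℓ]; push_cast
          field_simp
        rw [this, abs_mul, abs_of_pos hqR, mul_comm]
        exact mul_le_mul_of_nonneg_right h3 hqR.le
      rw [abs_le] at hb
      have hb1 : b ℓ ≤ N := Int.le_floor.mpr hb.2
      have hb2 : -b ℓ ≤ N := Int.le_floor.mpr (by push_cast; linarith)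
      have hr : (ℓ - 1) / q < g := by
        rw [Nat.div_lt_iff_lt_mul hqpos]
        have : d = g * q := by rw [hdq]; ring
        omega
      simp only [Finset.coe_product, Set.mem_prod, Finset.mem_coe, Finset.mem_Icc,
        Finset.mem_range]
      exact ⟨⟨by linarith, hb1⟩, hr⟩
    · intro x hx' y hy' hxy
      simp only [Finset.coe_filter, Finset.mem_Icc, Set.mem_ofPred_eq] at hx' hy'
      simp only [Prod.mk.injEq] at hxy
      obtain ⟨e1, e2⟩ := hxy
      have hdvd : (q : ℤ) ∣ ((x : ℤ) - y) * n := by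
        refine ⟨round (((x * m : ℕ) : ℝ) / (d : ℝ)) - round (((y * m : ℕ) : ℝ) / (d : ℝ)), ?_⟩
        simp only [b] at e1
        linarith
      have hc : IsCoprime (q : ℤ) (n : ℤ) := (Nat.isCoprime_iff_coprime.mpr hcop).symm
      have hdvd2 : (q : ℤ) ∣ (x : ℤ) - y := hc.dvd_of_dvd_mul_right hdvd
      have hmod : (y - 1) ≡ (x - 1) [MOD q] := by
        rw [Nat.modEq_iff_dvd]
        have : ((x - 1 : ℕ) : ℤ) - ((y - 1 : ℕ) : ℤ) = (x : ℤ) - y := by omega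
        rwa [this]
      have h1 := Nat.div_add_mod (x - 1) q
      have h2 := Nat.div_add_mod (y - 1) q
      have h3 : (y - 1) % q = (x - 1) % q := hmod
      rw [e2] at h1
      omega
  have hNs : (N : ℝ) ≤ s * q := Int.floor_le _
  have hcard2 : ((((Finset.Icc (-N) N) ×ˢ (Finset.range g)).card : ℕ) : ℝ)
      = (2 * N + 1) * g := by
    rw [Finset.card_product, Int.card_Icc, Finset.card_range]
    push_cast
    have h : (((N + 1 - -N).toNat : ℤ)) = 2 * N + 1 := by omega
    have h' : (((N + 1 - -N).toNat : ℝ)) = 2 * N + 1 := by exact_mod_cast h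
    rw [h']
  have hdR : (d : ℝ) = q * g := by
    rw [hdq]; push_cast; ring
  calc _ ≤ ((((Finset.Icc (-N) N) ×ˢ (Finset.range g)).card : ℕ) : ℝ) := by
        exact_mod_cast hcard
    _ = (2 * N + 1) * g := hcard2
    _ ≤ (3 * (s * q)) * g := by
        apply mul_le_mul_of_nonneg_right _ hgR.le
        linarith
    _ = 3 * s * d := by rw [hdR]; ring
end
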